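/- Let w ∈ ℕ and y₀, y₁ ∈ (ZMod 2)^w. Let φ ∈ ((ZMod 2 × (Fin w → ZMod 2)) → ℝ) be the vector with φ(0, y₀) = φ(1, y₁) = 1/√2 and all other entries 0, and let K be the matrix indexed by (ZMod 2 × (Fin w → ZMod 2))² with entries K((i,d),(j,y)) = 2^(−(w+1)/2)·χ(i·j + d·y). Then for every (i, d), the (i, d)-th entry of K · φ equals 2^(−w/2)·χ(d·y₀) if i = d·(y₀ + y₁), and equals 0 otherwise. -/

import Mathlib

/-- The dot product of two vectors over `ZMod 2`. -/
def dotp {w : ℕ} (d x : Fin w → ZMod 2) : ZMod 2 := ∑ i, d i * x i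

/-- The character `χ : ZMod 2 → ℝ` with `χ 0 = 1` and `χ 1 = -1`. -/
noncomputable def chi (a : ZMod 2) : ℝ := (-1 : ℝ) ^ a.val

/-- The `(w+1)`-qubit Hadamard transform on one qubit together with `w` qubits:
`K((i,d),(j,y)) = 2^(−(w+1)/2)·χ(i·j + d·y)`. -/
noncomputable def HadamardK (w : ℕ) :
    Matrix (ZMod 2 × (Fin w → ZMod 2)) (ZMod 2 × (Fin w → ZMod 2)) ℝ :=
  Matrix.of fun p q => (2 : ℝ) ^ (-((w : ℝ) + 1) / 2) * chi (p.1 * q.1 + dotp p.2 q.2)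

theorem dotp_add {w : ℕ} (d x y : Fin w → ZMod 2) : dotp d (x + y) = dotp d x + dotp d y := by
  simp [dotp, mul_add, Finset.sum_add_distrib]

theorem chi_zero : chi 0 = 1 := by simp [chi]

theorem chi_one : chi 1 = -1 := by simp [chi, ZMod.val_one]

theorem chi_add_chi_div_two (i a b : ZMod 2) :
    (chi a + chi (i + b)) / 2 = if i = a + b then chi a else 0 := by
  have h : (1 + 1 : ZMod 2) = 0 := rfl
  have hcases : ∀ x : ZMod 2, x = 0 ∨ x = 1 := by decide
  rcases hcases i with rfl | rfl <;> rcases hcases a with rfl | rfl <;>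
    rcases hcases b with rfl | rfl <;>
    simp only [h, add_zero, zero_add, chi_zero, chi_one] <;> norm_num

theorem two_rpow_div_sqrt_two (x : ℝ) :
    (2 : ℝ) ^ (-(x + 1) / 2) * (1 / Real.sqrt 2) * 2 = (2 : ℝ) ^ (-x / 2) := by
  have hexp : -x / 2 = -(x + 1) / 2 + 1 / 2 := by ring
  have hsqrt : (1 / Real.sqrt 2) * 2 = Real.sqrt 2 := by
    rw [one_div_mul_eq_div, Real.div_sqrt]
  rw [hexp, Real.rpow_add two_pos, ← Real.sqrt_eq_rpow, mul_assoc, hsqrt]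

/-- Displayed identity in the completeness proof of the NTCF-based 1-of-2 puzzle:
applying the Hadamard transform `K` to `(1/√2)(|0⟩|y₀⟩ + |1⟩|y₁⟩)` gives, at entry
`(i, d)`, the value `2^(−w/2)·χ(d·y₀)` if `i = d·(y₀ + y₁)`, and `0` otherwise. -/
theorem hadamard_equation_state (w : ℕ) (y₀ y₁ : Fin w → ZMod 2)
    (φ : ZMod 2 × (Fin w → ZMod 2) → ℝ)
    (hφ0 : φ (0, y₀) = 1 / Real.sqrt 2) (hφ1 : φ (1, y₁) = 1 / Real.sqrt 2)
    (hφother : ∀ p : ZMod 2 × (Fin w → ZMod 2), p ≠ (0, y₀) → p ≠ (1, y₁) → φ p = 0) :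
    ∀ (i : ZMod 2) (d : Fin w → ZMod 2),
      (HadamardK w).mulVec φ (i, d) =
        if i = dotp d (y₀ + y₁) then (2 : ℝ) ^ (-(w : ℝ) / 2) * chi (dotp d y₀)
        else 0 := by
  intro i d
  have hne : ((0 : ZMod 2), y₀) ≠ (1, y₁) := fun h => zero_ne_one (congrArg Prod.fst h)
  have hsum : (HadamardK w).mulVec φ (i, d) =
      HadamardK w (i, d) (0, y₀) * φ (0, y₀) + HadamardK w (i, d) (1, y₁) * φ (1, y₁) :=
    Fintype.sum_eq_add _ _ hne fun p hp => by rw [hφother p hp.1 hp.2, mul_zero]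
  have hfactor : (HadamardK w).mulVec φ (i, d) = (2 : ℝ) ^ (-(w : ℝ) / 2) *
      ((chi (dotp d y₀) + chi (i + dotp d y₁)) / 2) := by
    rw [hsum, hφ0, hφ1]
    simp only [HadamardK, Matrix.of_apply, mul_zero, mul_one, zero_add]
    rw [← two_rpow_div_sqrt_two (w : ℝ)]
    ring
  rw [hfactor, dotp_add, chi_add_chi_div_two, mul_ite, mul_zero]
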